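/- arXiv:2504.08667 — 7 statements merged into one kernel-verified Lean document; each statement's English description precedes it below -/
import Mathlib

section
/- Let G = (V, E, s) be a graph in which every node is reachable from s. If a, b, c ∈ V satisfy a ≥_s c and b ≥_s c, then a ≥_s b or b ≥_s a. -/
open Relation

variable {V : Type*}

/-- `p` is a path from `a` to `b` in the arc relation `E`:
a nonempty list of nodes starting at `a`, ending at `b`,
in which every consecutive pair of nodes is an arc. -/
def IsPath (E : V → V → Prop) (a b : V) (p : List V) : Prop :=
  p ≠ [] ∧ p.head? = some a ∧ p.getLast? = some b ∧ p.Chain' E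

/-- `a` dominates `b` (written `a ≥_s b`): every path from `s` to `b` contains `a`. -/
def Dom (E : V → V → Prop) (s a b : V) : Prop :=
  ∀ p : List V, IsPath E s b p → a ∈ p

/-- `m` is a source of module `M`: `m ∈ M`, every arc entering `M` from outside goes
to `m`, and (convention) if `s ∈ M` then `m = s`. -/
def ModuleSource (E : V → V → Prop) (s : V) (M : Set V) (m : V) : Prop :=
  m ∈ M ∧ (∀ u v, E u v → u ∉ M → v ∈ M → v = m) ∧ (s ∈ M → m = s)

/-- `M` is a module of the graph `(V, E, s)`. -/
def IsModule (E : V → V → Prop) (s : V) (M : Set V) : Prop :=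
  ∃ m, ModuleSource E s M m

/-- Two sets overlap: they intersect but neither contains the other. -/
def Overlap (M H : Set V) : Prop :=
  (M ∩ H).Nonempty ∧ ¬ M ⊆ H ∧ ¬ H ⊆ M

/-- A nesting decomposition: a collection of pairwise non-overlapping modules
containing the trivial modules (the whole node set and all singletons). -/
def IsNestingDecomp (E : V → V → Prop) (s : V) (F : Set (Set V)) : Prop :=
  (∀ M ∈ F, IsModule E s M) ∧
  (∀ M ∈ F, ∀ H ∈ F, ¬ Overlap M H) ∧
  (Set.univ : Set V) ∈ F ∧
  (∀ v : V, ({v} : Set V) ∈ F)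

/-- The maximal module partition of `M` within the family `F`. -/
def MaxPartition (F : Set (Set V)) (M : Set V) : Set (Set V) :=
  {H | H ∈ F ∧ H ⊂ M ∧ ¬ ∃ K ∈ F, H ⊂ K ∧ K ⊂ M}

/-- The width of a nesting decomposition `F`. -/
noncomputable def NDWidth (F : Set (Set V)) : ℕ :=
  ⨆ M ∈ F, (MaxPartition F M).ncard

/-- The nesting width of the graph `(V, E, s)`. -/
noncomputable def nestingWidth (E : V → V → Prop) (s : V) : ℕ :=
  sInf {w : ℕ | ∃ F : Set (Set V), IsNestingDecomp E s F ∧ NDWidth F = w}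

/-- `D(a)`: the set of nodes dominated by `a`. -/
def DomSet (E : V → V → Prop) (s a : V) : Set V := {v | Dom E s a v}

/-- `v` is a child of `a` in the dominator tree. -/
def IsChild (E : V → V → Prop) (s a v : V) : Prop :=
  v ≠ a ∧ Dom E s a v ∧ ∀ b, b ≠ a → b ≠ v → ¬(Dom E s a b ∧ Dom E s b v)

/-- `C(a)`: the set of children of `a` in the dominator tree. -/
def Children (E : V → V → Prop) (s a : V) : Set V := {v | IsChild E s a v}

/-- The arc relation of the graph `G_a` on the children of `a`. -/
def GArc (E : V → V → Prop) (s a : V) (u v : V) : Prop :=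
  u ∈ Children E s a ∧ v ∈ Children E s a ∧ u ≠ v ∧
    ∃ x y, E x y ∧ x ∈ DomSet E s u ∧ y ∈ DomSet E s v

/-- `S` is a strongly connected component of `G_a`
(an equivalence class of mutual reachability in `G_a`). -/
def IsSCC (E : V → V → Prop) (s a : V) (S : Set V) : Prop :=
  ∃ u ∈ Children E s a,
    S = {v | v ∈ Children E s a ∧ ReflTransGen (GArc E s a) u v ∧
          ReflTransGen (GArc E s a) v u}

/-- `L` lists the strongly connected components of `G_a` in topological order:
each member is an SCC of `G_a`, every child of `a` lies in exactly one listed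
component, and every arc of `G_a` goes from an earlier component to the same
or a later component. -/
def IsTopoSCCList (E : V → V → Prop) (s a : V) (L : List (Set V)) : Prop :=
  (∀ S ∈ L, IsSCC E s a S) ∧
  (∀ v ∈ Children E s a, ∃! i : Fin L.length, v ∈ L.get i) ∧
  (∀ i j : Fin L.length, ∀ u ∈ L.get i, ∀ v ∈ L.get j, GArc E s a u v → i ≤ j)

/-- `D(S) = ⋃_{v ∈ S} D(v)`. -/
def DSet (E : V → V → Prop) (s : V) (S : Set V) : Set V := ⋃ v ∈ S, DomSet E s v

/-- The set `{a} ∪ ⋃_{i=1}^{j} D(S^a_i)` (components indexed from 0 in the list). -/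
def PrefixModule (E : V → V → Prop) (s a : V) (L : List (Set V)) (j : ℕ) : Set V :=
  {a} ∪ ⋃ i ∈ Finset.range j, DSet E s (L.getD i ∅)

/-- The A-C family determined by a choice `L` of topologically ordered SCC lists. -/
def ACFamily (E : V → V → Prop) (s : V) (L : V → List (Set V)) : Set (Set V) :=
  {M | ∃ (a : V) (j : ℕ), j ≤ (L a).length ∧ M = PrefixModule E s a (L a) j}

/-- The quantity `max { |S^a_i| : a ∈ V, 1 ≤ i ≤ k_a }`. -/
noncomputable def MaxSCCSize (L : V → List (Set V)) : ℕ :=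
  ⨆ a : V, ⨆ i ∈ Finset.range (L a).length, ((L a).getD i ∅).ncard

theorem IsPath.singleton (E : V → V → Prop) (a : V) : IsPath E a a [a] :=
  ⟨by simp, rfl, rfl, List.isChain_singleton a⟩

theorem IsPath.concat {E : V → V → Prop} {a b c : V} {p : List V}
    (hp : IsPath E a b p) (hbc : E b c) : IsPath E a c (p ++ [c]) := by
  obtain ⟨hne, hhead, hlast, hchain⟩ := hp
  refine ⟨by simp, by simp [hhead], by simp, ?_⟩
  refine List.isChain_append.2 ⟨hchain, List.isChain_singleton c, ?_⟩
  intro x hx y hy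
  simp_all

theorem IsPath.reflTransGen {E : V → V → Prop} {a b : V} {p : List V}
    (hp : IsPath E a b p) : ReflTransGen E a b := by
  induction p generalizing a with
  | nil => exact absurd rfl hp.1
  | cons x p ih =>
    obtain ⟨-, hhead, hlast, hchain⟩ := hp
    obtain rfl : x = a := by simpa using hhead
    cases p with
    | nil =>
      obtain rfl : x = b := by simpa using hlast
      exact .refl
    | cons y p =>
      have hchain := List.isChain_cons_cons.1 hchain
      exact .head hchain.1 (ih ⟨by simp, by simp, by simpa using hlast, hchain.2⟩)

theorem not_dom_iff {E : V → V → Prop} {s a b : V} :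
    ¬ Dom E s a b ↔ ∃ p, IsPath E s b p ∧ a ∉ p := by
  simp [Dom]

theorem not_dom_source {E : V → V → Prop} {s a : V} (h : s ≠ a) : ¬ Dom E s a s :=
  not_dom_iff.2 ⟨[s], .singleton E s, by simpa using h.symm⟩

theorem not_dom_of_arc {E : V → V → Prop} {s a b c : V} (hab : ¬ Dom E s a b)
    (hbc : E b c) (hca : c ≠ a) : ¬ Dom E s a c := by
  obtain ⟨p, hp, hap⟩ := not_dom_iff.1 hab
  exact not_dom_iff.2 ⟨p ++ [c], hp.concat hbc, by simp [hap, hca.symm]⟩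

/-- If neither of `a` and `b` dominates the other, then no node reachable from the source is
dominated by both. -/
theorem not_dom_or_not_dom_of_reflTransGen {E : V → V → Prop} {s a b c : V}
    (hab : ¬ Dom E s a b) (hba : ¬ Dom E s b a) (hc : ReflTransGen E s c) :
    ¬ Dom E s a c ∨ ¬ Dom E s b c := by
  induction hc with
  | refl =>
    by_cases h : s = a
    · exact .inr (h ▸ hba)
    · exact .inl (not_dom_source h)
  | @tail x y _ hxy ih =>
    by_cases hya : y = a
    · exact .inr (hya ▸ hba)
    by_cases hyb : y = b
    · exact .inl (hyb ▸ hab)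
    exact ih.imp (not_dom_of_arc · hxy hya) (not_dom_of_arc · hxy hyb)

/-- if `a ≥_s c` and `b ≥_s c` then `a ≥_s b` or `b ≥_s a`. -/
theorem dominance_tree_order [Fintype V] (E : V → V → Prop) (s : V)
    (hreach : ∀ v : V, ∃ p : List V, IsPath E s v p)
    (a b c : V) (hac : Dom E s a c) (hbc : Dom E s b c) :
    Dom E s a b ∨ Dom E s b a := by
  by_contra! h
  obtain ⟨p, hp⟩ := hreach c
  exact (not_dom_or_not_dom_of_reflTransGen h.1 h.2 hp.reflTransGen).elim
    (· hac) (· hbc)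
end

section
/- Let G = (V, E, s) be a graph in which every node is reachable from s, and let M be a module of G with source m such that either s ∉ M or m = s. Then m ≥_s v for every v ∈ M, i.e., the source of a module dominates every node of the module. -/
open Relation

variable {V : Type*}

/-- A chain of arcs that starts outside `M` or at `m` and ends in `M` contains `m`, provided
that every arc entering `M` goes to `m`. -/
theorem mem_of_isChain_of_entering_arcs {E : V → V → Prop} {M : Set V} {m : V}
    (harc : ∀ u v, E u v → u ∉ M → v ∈ M → v = m) {v : V} (hv : v ∈ M) :
    ∀ (p : List V) (a : V), (a ∉ M ∨ m = a) → (a :: p).getLast? = some v →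
      (a :: p).IsChain E → m ∈ a :: p
  | _, _, .inr ha, _, _ => by simp [ha]
  | [], a, .inl ha, hlast, _ => by
    obtain rfl : a = v := by simpa using hlast
    exact absurd hv ha
  | b :: p, a, .inl ha, hlast, hchain => by
    rw [List.isChain_cons_cons] at hchain
    have hb : b ∉ M ∨ m = b := by
      by_cases hbM : b ∈ M
      · exact .inr (harc a b hchain.1 ha hbM).symm
      · exact .inl hbM
    exact List.mem_cons_of_mem a
      (mem_of_isChain_of_entering_arcs harc hv p b hb (by simpa using hlast) hchain.2)

/-- the source of a module dominates every node of the module. -/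
theorem module_source_dominates [Fintype V] (E : V → V → Prop) (s : V)
    (hreach : ∀ v : V, ∃ p : List V, IsPath E s v p)
    (M : Set V) (m : V) (hm : m ∈ M)
    (harc : ∀ u v, E u v → u ∉ M → v ∈ M → v = m)
    (hconv : s ∉ M ∨ m = s) :
    ∀ v ∈ M, Dom E s m v := by
  rintro v hv (_ | ⟨a, p⟩) ⟨hne, hhead, hlast, hchain⟩
  · exact absurd rfl hne
  · obtain rfl : a = s := by simpa using hhead
    exact mem_of_isChain_of_entering_arcs harc hv p a hconv hlast hchain
end

section
/- Let G = (V, E, s) be a graph in which every node is reachable from s, and let M and H be modules of G with sources m and h respectively, with s ∉ M ∪ H. If M ∩ H is nonempty and m ≥_s h, then h ∈ M ∩ H. -/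
open Relation

variable {V : Type*}

theorem IsPath.induction {E : V → V → Prop} {a b : V} {p : List V} (hp : IsPath E a b p)
    {P : V → Prop} (ha : P a) (hstep : ∀ u v, E u v → P u → P v) : P b := by
  obtain ⟨-, hhead, hlast, hchain⟩ := hp
  induction p generalizing a with
  | nil => simp at hhead
  | cons x l ih =>
    obtain rfl : x = a := by simpa using hhead
    cases l with
    | nil =>
      obtain rfl : x = b := by simpa using hlast
      exact ha
    | cons y l =>
      obtain ⟨hxy, hl⟩ := List.isChain_cons_cons.1 hchain
      exact ih (hstep x y hxy ha) rfl (by simpa using hlast) hl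

/-- for modules `M`, `H` with sources `m`, `h`, neither containing `s`,
if `M ∩ H ≠ ∅` and `m ≥_s h` then `h ∈ M ∩ H`. -/
theorem source_in_intersection [Fintype V] (E : V → V → Prop) (s : V)
    (hreach : ∀ v : V, ∃ p : List V, IsPath E s v p)
    (M H : Set V) (m h : V)
    (hmM : m ∈ M) (harcM : ∀ u v, E u v → u ∉ M → v ∈ M → v = m)
    (hhH : h ∈ H) (harcH : ∀ u v, E u v → u ∉ H → v ∈ H → v = h)
    (hs : s ∉ M ∪ H)
    (hne : (M ∩ H).Nonempty) (hdom : Dom E s m h) :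
    h ∈ M ∩ H := by
  obtain ⟨x, hxM, hxH⟩ := hne
  refine ⟨?_, hhH⟩
  by_contra hhM
  have hsM : s ∉ M := fun h' => hs (Or.inl h')
  have hsH : s ∉ H := fun h' => hs (Or.inr h')
  have hmH : m ∉ H := by
    intro hmH
    -- The nodes outside `H` reachable from `s` by a path avoiding `m` are closed under arcs.
    obtain ⟨p, hp⟩ := hreach m
    refine (hp.induction (P := fun v => v ∉ H ∧ ∃ q, IsPath E s v q ∧ m ∉ q) ?_ ?_).1 hmH
    · refine ⟨hsH, [s], ⟨by simp, rfl, rfl, List.isChain_singleton s⟩, ?_⟩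
      rintro hms
      exact hsM (List.mem_singleton.1 hms ▸ hmM)
    · rintro u v huv ⟨huH, q, hq, hmq⟩
      have hvm : v ≠ m := by
        rintro rfl
        exact hhM (harcH u v huv huH hmH ▸ hmM)
      have hmqv : m ∉ q ++ [v] := by simp [hmq, hvm.symm]
      refine ⟨fun hvH => ?_, q ++ [v], hq.concat huv, hmqv⟩
      obtain rfl := harcH u v huv huH hvH
      exact hmqv (hdom _ (hq.concat huv))
  obtain ⟨p, hp⟩ := hreach x
  refine hp.induction (P := fun v => ¬(v ∈ M ∧ v ∈ H)) (fun h' => hsM h'.1) ?_ ⟨hxM, hxH⟩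
  rintro u v huv hu ⟨hvM, hvH⟩
  by_cases huM : u ∈ M
  · exact hhM (harcH u v huv (fun huH => hu ⟨huM, huH⟩) hvH ▸ hvM)
  · exact hmH (harcM u v huv huM hvM ▸ hvH)
end

section
/- Let G = (V, E, s) be a graph in which every node is reachable from s, and let M and H be overlapping modules of G with sources m and h respectively. If both m ∈ M ∩ H and h ∈ M ∩ H, then m = h. -/
open Relation

variable {V : Type*}

/-- A chain of arcs leading from outside `S` into `S` has an arc that enters `S`. -/
theorem exists_arc_entering {E : V → V → Prop} {S : Set V} {b : V} (hb : b ∈ S) :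
    ∀ (l : List V) (a : V), a ∉ S → (a :: l).getLast? = some b → (a :: l).IsChain E →
      ∃ u v, E u v ∧ u ∉ S ∧ v ∈ S
  | [], a, ha, hlast, _ => by
    simp only [List.getLast?_singleton, Option.some.injEq] at hlast
    exact absurd (hlast ▸ hb) ha
  | c :: l, a, ha, hlast, hchain => by
    rw [List.isChain_cons_cons] at hchain
    by_cases hc : c ∈ S
    · exact ⟨a, c, hchain.1, ha, hc⟩
    · rw [List.getLast?_cons_cons] at hlast
      exact exists_arc_entering hb l c hc hlast hchain.2

/-- for overlapping modules `M`, `H` with sources `m`, `h`,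
if both `m` and `h` lie in `M ∩ H` then `m = h`. -/
theorem sources_in_intersection_eq [Fintype V] (E : V → V → Prop) (s : V)
    (hreach : ∀ v : V, ∃ p : List V, IsPath E s v p)
    (M H : Set V) (m h : V)
    (hM : ModuleSource E s M m) (hH : ModuleSource E s H h)
    (hov : Overlap M H)
    (hm : m ∈ M ∩ H) (hh : h ∈ M ∩ H) :
    m = h := by
  obtain ⟨-, hM_arc, hM_s⟩ := hM
  obtain ⟨-, hH_arc, hH_s⟩ := hH
  by_cases hs : s ∈ M ∪ H
  · rcases hs with hs | hs
    · have hms := hM_s hs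
      exact hms.trans (hH_s (hms ▸ hm.2)).symm
    · have hhs := hH_s hs
      exact (hM_s (hhs ▸ hh.1)).trans hhs.symm
  · obtain ⟨p, hne, hhead, hlast, hchain⟩ := hreach m
    obtain ⟨u, v, huv, hu, hv⟩ : ∃ u v, E u v ∧ u ∉ M ∪ H ∧ v ∈ M ∪ H := by
      cases p with
      | nil => exact absurd rfl hne
      | cons a l =>
        obtain rfl : a = s := by simpa using hhead
        exact exists_arc_entering (Or.inl hm.1) l a hs hlast hchain
    have huM : u ∉ M := fun h' => hu (Or.inl h')
    have huH : u ∉ H := fun h' => hu (Or.inr h')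
    rcases hv with hv | hv
    · have hvm := hM_arc u v huv huM hv
      exact hvm.symm.trans (hH_arc u v huv huH (hvm ▸ hm.2))
    · have hvh := hH_arc u v huv huH hv
      exact (hM_arc u v huv huM (hvh ▸ hh.1)).symm.trans hvh
end

section
/- Let G = (V, E, s) be a graph in which every node is reachable from s. If M and H are overlapping modules of G, then M ∩ H is a module of G. -/
open Relation

variable {V : Type*}

/-- A path ending in `S` either starts in `S` or traverses an arc entering `S`. -/
theorem IsPath.start_mem_or_exists_entering_arc {E : V → V → Prop} {S : Set V}
    {a b : V} {p : List V} (hp : IsPath E a b p) (hb : b ∈ S) :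
    a ∈ S ∨ ∃ u v, E u v ∧ u ∉ S ∧ v ∈ S := by
  induction p generalizing a with
  | nil => exact absurd rfl hp.1
  | cons c l ih =>
    obtain ⟨-, hhead, hlast, hchain⟩ := hp
    obtain rfl : c = a := by simpa using hhead
    cases l with
    | nil =>
      obtain rfl : c = b := by simpa using hlast
      exact Or.inl hb
    | cons d l =>
      have hcd := List.isChain_cons_cons.mp hchain
      have htail : IsPath E d b (d :: l) := ⟨by simp, rfl, by simpa using hlast, hcd.2⟩
      rcases ih htail with hd | harc
      · by_cases hc : c ∈ S
        · exact Or.inl hc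
        · exact Or.inr ⟨c, d, hcd.1, hc, hd⟩
      · exact Or.inr harc

/-- If each of two modules contains the source of the other, their sources coincide. -/
theorem ModuleSource.eq_of_mem_of_mem {E : V → V → Prop} {s : V} {M H : Set V}
    {m h : V} (hM : ModuleSource E s M m) (hH : ModuleSource E s H h)
    (hreach : ∃ p : List V, IsPath E s m p) (hmH : m ∈ H) (hhM : h ∈ M) : m = h := by
  obtain ⟨hm, hMarc, hMs⟩ := hM
  obtain ⟨hh, hHarc, hHs⟩ := hH
  obtain ⟨p, hp⟩ := hreach
  rcases hp.start_mem_or_exists_entering_arc (S := M ∪ H) (Or.inl hm) with hs | ⟨u, v, huv, hu, hv⟩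
  · grind
  · grind

/-- If a module `M` contains the source of a module `H`, then `M ∩ H` is a module with the
same source as `H`. -/
theorem ModuleSource.inter_of_mem {E : V → V → Prop} {s : V} {M H : Set V}
    {m h : V} (hM : ModuleSource E s M m) (hH : ModuleSource E s H h)
    (hreach : ∃ p : List V, IsPath E s m p) (hhM : h ∈ M) :
    ModuleSource E s (M ∩ H) h := by
  refine ⟨⟨hhM, hH.1⟩, fun u v huv hu hv => ?_, fun hs => hH.2.2 hs.2⟩
  by_cases huH : u ∈ H
  · obtain rfl : v = m := hM.2.1 u v huv (fun huM => hu ⟨huM, huH⟩) hv.1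
    exact hM.eq_of_mem_of_mem hH hreach hv.2 hhM
  · exact hH.2.1 u v huv huH hv.2

/-- If two modules share a reachable node, one of them contains the source of the other. -/
theorem ModuleSource.mem_or_mem {E : V → V → Prop} {s : V} {M H : Set V}
    {m h x : V} (hM : ModuleSource E s M m) (hH : ModuleSource E s H h)
    (hreach : ∃ p : List V, IsPath E s x p) (hx : x ∈ M ∩ H) : m ∈ H ∨ h ∈ M := by
  obtain ⟨hm, hMarc, hMs⟩ := hM
  obtain ⟨hh, hHarc, hHs⟩ := hH
  obtain ⟨p, hp⟩ := hreach
  rcases hp.start_mem_or_exists_entering_arc hx with hs | ⟨u, v, huv, hu, hv⟩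
  · grind
  · grind

/-- the intersection of two overlapping modules is a module. -/
theorem inter_of_overlapping_modules [Fintype V] (E : V → V → Prop) (s : V)
    (hreach : ∀ v : V, ∃ p : List V, IsPath E s v p)
    (M H : Set V) (hM : IsModule E s M) (hH : IsModule E s H)
    (hov : Overlap M H) :
    IsModule E s (M ∩ H) := by
  obtain ⟨m, hm⟩ := hM
  obtain ⟨h, hh⟩ := hH
  obtain ⟨x, hx⟩ := hov.1
  rcases hm.mem_or_mem hh (hreach x) hx with hmH | hhM
  · rw [Set.inter_comm]
    exact ⟨m, hh.inter_of_mem hm (hreach h) hmH⟩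
  · exact ⟨h, hm.inter_of_mem hh (hreach m) hhM⟩
end

section
/- Let G = (V, E, s) be a graph in which every node is reachable from s. If M and H are overlapping modules of G, then M ∪ H is a module of G. -/
open Relation

variable {V : Type*}

/-- A set closed under predecessors that contains the last node of a path contains the first. -/
theorem IsPath.head_mem_of_getLast_mem {E : V → V → Prop} {S : Set V}
    (hS : ∀ u v, E u v → v ∈ S → u ∈ S) {a b : V} {p : List V}
    (hp : IsPath E a b p) (hb : b ∈ S) : a ∈ S := by
  obtain ⟨hne, ha, hl, hc⟩ := hp
  induction p generalizing a with
  | nil => exact absurd rfl hne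
  | cons x t ih =>
    obtain rfl : x = a := by simpa using ha
    cases t with
    | nil =>
      obtain rfl : x = b := by simpa using hl
      exact hb
    | cons y t =>
      obtain ⟨hxy, hc⟩ := List.isChain_cons_cons.1 hc
      exact hS x y hxy (ih (by simp) rfl (by simpa using hl) hc)

/-- If the source of `M` lies in `H`, then the source of `H` is a source of `M ∪ H`. -/
theorem ModuleSource.union {E : V → V → Prop} {s : V} {M H : Set V} {m h : V}
    (hM : ModuleSource E s M m) (hH : ModuleSource E s H h) (hm : m ∈ H) :
    ModuleSource E s (M ∪ H) h := by
  obtain ⟨-, hMarc, hMs⟩ := hM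
  obtain ⟨hh, hHarc, hHs⟩ := hH
  refine ⟨Or.inr hh, fun u v huv hu hv => ?_, ?_⟩
  · have huM : u ∉ M := fun hu' => hu (Or.inl hu')
    have huH : u ∉ H := fun hu' => hu (Or.inr hu')
    refine hHarc u v huv huH (hv.elim (fun hv => ?_) id)
    exact hMarc u v huv huM hv ▸ hm
  · rintro (hs | hs)
    · exact hHs (hMs hs ▸ hm)
    · exact hHs hs

/-- If two modules intersect, then one of them contains the source of the other. -/
theorem ModuleSource.mem_or_mem_of_inter_nonempty {E : V → V → Prop} {s : V}
    (hreach : ∀ v : V, ∃ p : List V, IsPath E s v p) {M H : Set V} {m h : V}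
    (hM : ModuleSource E s M m) (hH : ModuleSource E s H h) (hne : (M ∩ H).Nonempty) :
    m ∈ H ∨ h ∈ M := by
  by_contra! hcon
  obtain ⟨x, hx⟩ := hne
  obtain ⟨p, hp⟩ := hreach x
  have hpred : ∀ u v, E u v → v ∈ M ∩ H → u ∈ M ∩ H := by
    intro u v huv hv
    constructor
    · by_contra hu
      exact hcon.1 (hM.2.1 u v huv hu hv.1 ▸ hv.2)
    · by_contra hu
      exact hcon.2 (hH.2.1 u v huv hu hv.2 ▸ hv.1)
  have hs := hp.head_mem_of_getLast_mem hpred hx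
  exact hcon.1 (hM.2.2 hs.1 ▸ hs.2)

/-- the union of two overlapping modules is a module. -/
theorem union_of_overlapping_modules [Fintype V] (E : V → V → Prop) (s : V)
    (hreach : ∀ v : V, ∃ p : List V, IsPath E s v p)
    (M H : Set V) (hM : IsModule E s M) (hH : IsModule E s H)
    (hov : Overlap M H) :
    IsModule E s (M ∪ H) := by
  obtain ⟨m, hm⟩ := hM
  obtain ⟨h, hh⟩ := hH
  rcases hm.mem_or_mem_of_inter_nonempty hreach hh hov.1 with hmH | hhM
  · exact ⟨h, hm.union hh hmH⟩
  · exact ⟨m, Set.union_comm H M ▸ hh.union hm hhM⟩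
end

section
/- Let G = (V, E, s) be a graph in which every node is reachable from s. For every node v ∈ V, the set D(v) = {u ∈ V : v ≥_s u} of all nodes dominated by v is a module of G with source v. -/
open Relation

variable {V : Type*}

theorem Dom.refl (E : V → V → Prop) (s a : V) : Dom E s a a :=
  fun _ hp => List.mem_of_getLast? hp.2.2.1

theorem Dom.eq_source {E : V → V → Prop} {s a : V} (h : Dom E s a s) : a = s := by
  simpa using h [s] (IsPath.singleton E s)

/-- An arc from a node not dominated by `a` to a node dominated by `a` ends in `a`. -/
theorem Dom.eq_of_arc {E : V → V → Prop} {s a u w : V} (huw : E u w)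
    (hu : ¬ Dom E s a u) (hw : Dom E s a w) : w = a := by
  simp only [Dom, not_forall] at hu
  obtain ⟨p, hp, hap⟩ := hu
  rcases List.mem_append.mp (hw _ (hp.concat huw)) with h | h
  · exact absurd h hap
  · exact (List.mem_singleton.mp h).symm

/-- for every node `v`, the set `D(v)` of nodes dominated by `v`
is a module with source `v`. -/
theorem domSet_is_module [Fintype V] (E : V → V → Prop) (s : V)
    (hreach : ∀ v : V, ∃ p : List V, IsPath E s v p) :
    ∀ v : V, ModuleSource E s (DomSet E s v) v := by
  exact fun v => ⟨Dom.refl E s v, fun _ _ huw hu hw => Dom.eq_of_arc huw hu hw, Dom.eq_source⟩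
end
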